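/- arXiv:2208.10288 — 4 statements merged into one kernel-verified Lean document; each statement's English description precedes it below -/
import Mathlib

section
/- Let X be a real Banach space, let L₁, L₂ ⊆ X be affine lines, and for i = 1, 2 let Π_i : X → X be a 1-Lipschitz map with Π_i(x) ∈ L_i for all x ∈ X and Π_i(x) = x for all x ∈ L_i. Let δ > 0, let 0 ≤ α < 1/6, and let V ⊆ X be a set such that ‖v − w‖ ≥ δ for all distinct v, w ∈ V and ‖v − Π_i(v)‖ ≤ α·δ for all v ∈ V and i = 1, 2. Then: (a) for i = 1, 2 and all v₁, v₂ ∈ V, ‖Π_i(v₁) − Π_i(v₂)‖ ≤ ‖v₁ − v₂‖ ≤ (1 + 3α)·‖Π_i(v₁) − Π_i(v₂)‖; (b) there exist surjective isometries γ_i : ℝ → L_i (i = 1, 2) such that for all v', v'' ∈ V, γ₁⁻¹(Π₁(v')) ≤ γ₁⁻¹(Π₁(v'')) if and only if γ₂⁻¹(Π₂(v')) ≤ γ₂⁻¹(Π₂(v'')); (c) for every x ∈ X and r > 0, the set V ∩ B(x, r·δ) is finite with cardinality at most 1 + 3r. -/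
open Metric Set

universe u

noncomputable section

/-- The affine line through `a` with direction `v`. -/
def lineThrough {X : Type u} [AddCommGroup X] [Module ℝ X] (a v : X) : Set X :=
  {y | ∃ t : ℝ, y = a + t • v}

theorem exists_isometry_range_eq_lineThrough {X : Type u} [NormedAddCommGroup X]
    [NormedSpace ℝ X] (a : X) {v : X} (hv : v ≠ 0) :
    ∃ γ : ℝ → X, Isometry γ ∧ Set.range γ = lineThrough a v := by
  have hv' : ‖v‖ ≠ 0 := norm_ne_zero_iff.mpr hv
  refine ⟨fun t => a + (t / ‖v‖) • v, Isometry.of_dist_eq fun s t => ?_, ?_⟩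
  · rw [dist_add_left, dist_eq_norm, ← sub_smul, norm_smul, ← sub_div, norm_div, norm_norm,
      div_mul_cancel₀ _ hv', Real.dist_eq, Real.norm_eq_abs]
  · ext y
    constructor
    · rintro ⟨t, rfl⟩
      exact ⟨t / ‖v‖, rfl⟩
    · rintro ⟨t, rfl⟩
      exact ⟨t * ‖v‖, by simp [hv']⟩

/-- A 1-Lipschitz map onto a line factors through an isometric parametrization of the line. -/
theorem exists_isometry_coordinate {X : Type u} [NormedAddCommGroup X] [NormedSpace ℝ X]
    {L : Set X} (hL : ∃ a v : X, v ≠ 0 ∧ L = lineThrough a v) {P : X → X}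
    (hP : ∀ x, P x ∈ L) :
    ∃ (γ : ℝ → X) (f : X → ℝ), Isometry γ ∧ Set.range γ = L ∧ (∀ x, γ (f x) = P x) ∧
      ∀ x y, |f x - f y| = ‖P x - P y‖ := by
  obtain ⟨a, v, hv, rfl⟩ := hL
  obtain ⟨γ, hγ, hr⟩ := exists_isometry_range_eq_lineThrough a hv
  have h : ∀ x, ∃ t, γ t = P x := fun x => by
    have := hP x
    rwa [← hr] at this
  choose f hf using h
  refine ⟨γ, f, hγ, hr, hf, fun x y => ?_⟩
  rw [← hf, ← hf, ← dist_eq_norm, hγ.dist_eq, Real.dist_eq]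

theorem norm_sub_le_norm_sub_add {X : Type u} [NormedAddCommGroup X] {P : X → X} {ε : ℝ} {v w : X}
    (hv : ‖v - P v‖ ≤ ε) (hw : ‖w - P w‖ ≤ ε) : ‖v - w‖ ≤ ‖P v - P w‖ + 2 * ε := by
  have h : v - w = (v - P v) + (P v - P w) - (w - P w) := by abel
  have h₁ := norm_sub_le ((v - P v) + (P v - P w)) (w - P w)
  have h₂ := norm_add_le (v - P v) (P v - P w)
  rw [h]
  linarith

theorem norm_sub_le_mul_norm_sub {X : Type u} [NormedAddCommGroup X] {P : X → X} {δ α : ℝ}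
    (hα0 : 0 ≤ α) (hα : α < 1 / 6) {v w : X} (hsep : v ≠ w → δ ≤ ‖v - w‖)
    (hv : ‖v - P v‖ ≤ α * δ) (hw : ‖w - P w‖ ≤ α * δ) :
    ‖v - w‖ ≤ (1 + 3 * α) * ‖P v - P w‖ := by
  rcases eq_or_ne v w with rfl | hne
  · simp
  have h := norm_sub_le_norm_sub_add hv hw
  have h₁ := mul_le_mul_of_nonneg_left (hsep hne) hα0
  have h₂ : (1 - 2 * α) * ‖v - w‖ ≤ ‖P v - P w‖ := by linarith
  have h₃ := mul_le_mul_of_nonneg_left h₂ (by linarith : 0 ≤ 1 + 3 * α)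
  have h₄ : 0 ≤ α * (1 - 6 * α) * ‖v - w‖ :=
    mul_nonneg (mul_nonneg hα0 (by linarith)) (norm_nonneg _)
  linarith

/-- Two pairs of real displacements that agree in absolute value up to `c`, as do their
differences, and of which all but `y` are assumed longer than `2 * c`, have the same relative orientation. -/
theorem mul_pos_of_abs_sub_abs_le {c x y z t : ℝ} (hx : 2 * c < |x|) (hz : 2 * c < |z|)
    (ht : 2 * c < |t|) (hxy : |(|x| - |y|)| ≤ c)
    (hzt : |(|z| - |t|)| ≤ c) (hxyzt : |(|x - z| - |y - t|)| ≤ c) (hpos : 0 < x * y) :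
    0 < z * t := by
  rw [abs_le] at hxy hzt hxyzt
  have hc : 0 ≤ c := by linarith
  have hz0 : z ≠ 0 := by
    rintro rfl
    rw [abs_zero] at hz
    linarith
  have ht0 : t ≠ 0 := by
    rintro rfl
    rw [abs_zero] at ht
    linarith
  rcases pos_and_pos_or_neg_and_neg_of_mul_pos hpos with ⟨hx0, hy0⟩ | ⟨hx0, hy0⟩ <;>
  rcases lt_or_gt_of_ne hz0 with hz0 | hz0 <;> rcases lt_or_gt_of_ne ht0 with ht0 | ht0 <;>
  first
  | exact mul_pos hz0 ht0
  | exact mul_pos_of_neg_of_neg hz0 ht0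
  | exfalso
    simp only [abs_of_pos, abs_of_neg, hx0, hy0, hz0, ht0] at hx hz ht hxy hzt
    rcases abs_cases (x - z) with h | h <;> rcases abs_cases (y - t) with h' | h' <;> linarith

/-- If on `V` the functions `f` and `g` induce distances that differ by at most `c` and exceed
`2 * c`, then `g` is, up to a global sign, ordered as `f`. -/
theorem exists_sign_forall_mul_pos {X : Type u} {V : Set X} {f g : X → ℝ} {c : ℝ}
    (hf : ∀ v ∈ V, ∀ w ∈ V, v ≠ w → 2 * c < |f v - f w|)
    (hg : ∀ v ∈ V, ∀ w ∈ V, v ≠ w → 2 * c < |g v - g w|)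
    (hfg : ∀ v ∈ V, ∀ w ∈ V, |(|f v - f w| - |g v - g w|)| ≤ c) :
    ∃ ε : ℝ, (ε = 1 ∨ ε = -1) ∧
      ∀ v ∈ V, ∀ w ∈ V, v ≠ w → 0 < (f v - f w) * (ε * g v - ε * g w) := by
  have comm : ∀ v w, (f v - f w) * (g v - g w) = (f w - f v) * (g w - g v) := by
    intros; ring
  have share : ∀ u ∈ V, ∀ v ∈ V, ∀ w ∈ V, u ≠ v → u ≠ w →
      0 < (f u - f v) * (g u - g v) → 0 < (f u - f w) * (g u - g w) := by
    intro u hu v hv w hw huv huw h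
    refine mul_pos_of_abs_sub_abs_le (hf u hu v hv huv) (hf u hu w hw huw) (hg u hu w hw huw)
      (hfg u hu v hv) (hfg u hu w hw) ?_ h
    simpa only [sub_sub_sub_cancel_left] using hfg w hw v hv
  by_cases hex : ∃ v ∈ V, ∃ w ∈ V, v ≠ w ∧ 0 < (f v - f w) * (g v - g w)
  · obtain ⟨a, ha, b, hb, hab, h⟩ := hex
    refine ⟨1, Or.inl rfl, fun v hv w hw hvw => ?_⟩
    rw [one_mul, one_mul]
    by_cases hav : a = v
    · subst hav
      exact share a ha b hb w hw hab hvw h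
    · have h₁ := share a ha b hb v hv hab hav h
      rw [comm] at h₁
      exact share v hv a ha w hw (Ne.symm hav) hvw h₁
  · push Not at hex
    refine ⟨-1, Or.inr rfl, fun v hv w hw hvw => ?_⟩
    have hc : 0 ≤ c := (abs_nonneg _).trans (hfg v hv w hw)
    have h₁ := hf v hv w hw hvw
    have h₂ := hg v hv w hw hvw
    have hf0 : f v - f w ≠ 0 := abs_pos.mp (by linarith)
    have hg0 : g v - g w ≠ 0 := abs_pos.mp (by linarith)
    have := lt_of_le_of_ne (hex v hv w hw hvw) (mul_ne_zero hf0 hg0)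
    linarith

/-- A set on which a bounded real function has values at mutual distance at least `d` is finite,
with the expected bound on its cardinality. -/
theorem finite_and_ncard_le_of_separated {X : Type u} {S : Set X} {f : X → ℝ} {d m ℓ : ℝ}
    (hd : 0 < d) (hℓ : 0 ≤ ℓ) (hS : ∀ v ∈ S, m ≤ f v ∧ f v ≤ m + ℓ)
    (hsep : ∀ v ∈ S, ∀ w ∈ S, v ≠ w → d ≤ |f v - f w|) :
    S.Finite ∧ (S.ncard : ℝ) ≤ 1 + ℓ / d := by
  set q : X → ℕ := fun v => ⌊(f v - m) / d⌋₊
  set T : Set ℕ := ↑(Finset.range (⌊ℓ / d⌋₊ + 1))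
  have hT : T.Finite := Finset.finite_toSet _
  have hmaps : MapsTo q S T := by
    intro v hv
    have : (f v - m) / d ≤ ℓ / d := by
      gcongr
      linarith [(hS v hv).2]
    simpa [T, q, Nat.lt_succ_iff] using Nat.floor_le_floor this
  have hinj : InjOn q S := by
    intro v hv w hw h
    by_contra hvw
    have hpos : ∀ u ∈ S, 0 ≤ (f u - m) / d := fun u hu =>
      div_nonneg (by linarith [(hS u hu).1]) hd.le
    have h₁ := Nat.floor_le (hpos v hv)
    have h₂ := Nat.lt_floor_add_one ((f v - m) / d)
    have h₃ := Nat.floor_le (hpos w hw)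
    have h₄ := Nat.lt_floor_add_one ((f w - m) / d)
    have h' : (⌊(f v - m) / d⌋₊ : ℝ) = ⌊(f w - m) / d⌋₊ := congrArg Nat.cast h
    have h₅ : |(f v - f w) / d| < 1 := by
      have : (f v - f w) / d = (f v - m) / d - (f w - m) / d := by ring
      rw [this, abs_lt]
      constructor <;> linarith
    rw [abs_div, abs_of_pos hd, div_lt_one hd] at h₅
    exact absurd (hsep v hv w hw hvw) (not_le.mpr h₅)
  refine ⟨Finite.of_injOn hmaps hinj hT, ?_⟩
  have hcard : S.ncard ≤ ⌊ℓ / d⌋₊ + 1 := by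
    have := ncard_le_ncard_of_injOn q hmaps hinj hT
    rwa [ncard_coe_finset, Finset.card_range] at this
  have hfloor := Nat.floor_le (div_nonneg hℓ hd.le)
  have : (S.ncard : ℝ) ≤ ⌊ℓ / d⌋₊ + 1 := by exact_mod_cast hcard
  linarith

/-- Lemma C.3: a `δ`-separated set that lies within `α·δ` (with `α < 1/6`) of two
lines, via 1-Lipschitz projections fixing the lines, projects bi-Lipschitzly,
admits a compatible ordering along both lines, and is locally finite. -/
theorem statement11 (X : Type u) [NormedAddCommGroup X] [NormedSpace ℝ X] [CompleteSpace X]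
    (L₁ L₂ : Set X) (hL₁ : ∃ a v : X, v ≠ 0 ∧ L₁ = lineThrough a v)
    (hL₂ : ∃ a v : X, v ≠ 0 ∧ L₂ = lineThrough a v)
    (P₁ P₂ : X → X)
    (hP₁mem : ∀ x, P₁ x ∈ L₁) (hP₁fix : ∀ x ∈ L₁, P₁ x = x)
    (hP₁lip : ∀ x y, ‖P₁ x - P₁ y‖ ≤ ‖x - y‖)
    (hP₂mem : ∀ x, P₂ x ∈ L₂) (hP₂fix : ∀ x ∈ L₂, P₂ x = x)
    (hP₂lip : ∀ x y, ‖P₂ x - P₂ y‖ ≤ ‖x - y‖)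
    (δ α : ℝ) (hδ : 0 < δ) (hα0 : 0 ≤ α) (hα : α < 1 / 6)
    (V : Set X) (hsep : ∀ v ∈ V, ∀ w ∈ V, v ≠ w → δ ≤ ‖v - w‖)
    (hclose₁ : ∀ v ∈ V, ‖v - P₁ v‖ ≤ α * δ)
    (hclose₂ : ∀ v ∈ V, ‖v - P₂ v‖ ≤ α * δ) :
    ((∀ v₁ ∈ V, ∀ v₂ ∈ V,
        (‖P₁ v₁ - P₁ v₂‖ ≤ ‖v₁ - v₂‖ ∧ ‖v₁ - v₂‖ ≤ (1 + 3 * α) * ‖P₁ v₁ - P₁ v₂‖) ∧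
        (‖P₂ v₁ - P₂ v₂‖ ≤ ‖v₁ - v₂‖ ∧ ‖v₁ - v₂‖ ≤ (1 + 3 * α) * ‖P₂ v₁ - P₂ v₂‖))) ∧
    (∃ γ₁ γ₂ : ℝ → X, Isometry γ₁ ∧ Set.range γ₁ = L₁ ∧ Isometry γ₂ ∧ Set.range γ₂ = L₂ ∧
      ∀ v' ∈ V, ∀ v'' ∈ V, ∀ t' t'' s' s'' : ℝ,
        γ₁ t' = P₁ v' → γ₁ t'' = P₁ v'' → γ₂ s' = P₂ v' → γ₂ s'' = P₂ v'' →
        (t' ≤ t'' ↔ s' ≤ s'')) ∧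
    (∀ (x : X) (r : ℝ), 0 < r →
      (V ∩ closedBall x (r * δ)).Finite ∧
        ((V ∩ closedBall x (r * δ)).ncard : ℝ) ≤ 1 + 3 * r) := by
  obtain ⟨γ₁, f, hγ₁, hr₁, hf, hfd⟩ := exists_isometry_coordinate hL₁ hP₁mem
  obtain ⟨γ₂, g, hγ₂, hr₂, hg, hgd⟩ := exists_isometry_coordinate hL₂ hP₂mem
  have hαδ : α * δ < δ / 6 := by nlinarith
  have hf_low : ∀ v ∈ V, ∀ w ∈ V, ‖v - w‖ ≤ |f v - f w| + 2 * (α * δ) := by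
    intro v hv w hw
    rw [hfd]
    exact norm_sub_le_norm_sub_add (hclose₁ v hv) (hclose₁ w hw)
  have hg_low : ∀ v ∈ V, ∀ w ∈ V, ‖v - w‖ ≤ |g v - g w| + 2 * (α * δ) := by
    intro v hv w hw
    rw [hgd]
    exact norm_sub_le_norm_sub_add (hclose₂ v hv) (hclose₂ w hw)
  refine ⟨fun v hv w hw => ⟨⟨hP₁lip v w, ?_⟩, hP₂lip v w, ?_⟩, ?_, fun x r hr => ?_⟩
  · exact norm_sub_le_mul_norm_sub hα0 hα (hsep v hv w hw) (hclose₁ v hv) (hclose₁ w hw)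
  · exact norm_sub_le_mul_norm_sub hα0 hα (hsep v hv w hw) (hclose₂ v hv) (hclose₂ w hw)
  · obtain ⟨ε, hε, hmono⟩ := exists_sign_forall_mul_pos (V := V) (f := f) (g := g)
      (c := 2 * (α * δ))
      (fun v hv w hw hvw => by linarith [hsep v hv w hw hvw, hf_low v hv w hw])
      (fun v hv w hw hvw => by linarith [hsep v hv w hw hvw, hg_low v hv w hw])
      (fun v hv w hw => by
        have h₁ := hP₁lip v w
        have h₂ := hP₂lip v w
        rw [← hfd] at h₁
        rw [← hgd] at h₂
        rw [abs_le]
        constructor <;> linarith [hf_low v hv w hw, hg_low v hv w hw])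
    have hεε : ε * ε = 1 := by rcases hε with rfl | rfl <;> norm_num
    have hε_isom : Isometry fun t : ℝ => ε * t := Isometry.of_dist_eq fun s t => by
      rw [Real.dist_eq, Real.dist_eq, ← mul_sub, abs_mul]
      rcases hε with rfl | rfl <;> simp
    have hε_surj : Function.Surjective fun t : ℝ => ε * t := fun t =>
      ⟨ε * t, by simp only [← mul_assoc, hεε, one_mul]⟩
    refine ⟨γ₁, γ₂ ∘ fun t => ε * t, hγ₁, hr₁, hγ₂.comp hε_isom,
      (hε_surj.range_comp γ₂).trans hr₂, ?_⟩
    have hγ₂_coord : ∀ v s, (γ₂ ∘ fun t => ε * t) s = P₂ v → s = ε * g v := by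
      intro v s hs
      rw [← hg] at hs
      rw [← hγ₂.injective hs, ← mul_assoc, hεε, one_mul]
    intro v hv w hw t t' s s' ht ht' hs hs'
    rw [← hf] at ht ht'
    rw [hγ₁.injective ht, hγ₁.injective ht', hγ₂_coord v s hs, hγ₂_coord w s' hs']
    rcases eq_or_ne v w with rfl | hvw
    · simp
    rcases pos_and_pos_or_neg_and_neg_of_mul_pos (hmono v hv w hw hvw) with ⟨h₁, h₂⟩ | ⟨h₁, h₂⟩
    · exact iff_of_false (by linarith) (by linarith)
    · exact iff_of_true (by linarith) (by linarith)
  · have key := finite_and_ncard_le_of_separated (S := V ∩ closedBall x (r * δ)) (f := f)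
      (d := 2 / 3 * δ) (m := f x - r * δ) (ℓ := 2 * (r * δ)) (by positivity) (by positivity)
      (fun v hv => by
        have h₁ := (hP₁lip v x).trans (mem_closedBall_iff_norm.mp hv.2)
        rw [← hfd, abs_le] at h₁
        constructor <;> linarith)
      (fun v hv w hw hvw => by
        linarith [hsep v hv.1 w hw.1 hvw, hf_low v hv.1 w hw.1])
    have hratio : 2 * (r * δ) / (2 / 3 * δ) = 3 * r := by
      field_simp
    rwa [hratio] at key

end
end

section
/- Let X be a real Banach space, let x ∈ X, r > 0, 0 < s < 1, and let c, d ∈ B(x, r) (the closed ball of radius r around x). Suppose the segment from c to d intersects B(x, s·r), i.e., there exists ρ ∈ [0, 1] with ‖(1 − ρ)·c + ρ·d − x‖ ≤ s·r. Then for all μ ∈ [0, 1], ‖(1 − μ)·c + μ·d − x‖ ≤ r − r·(1 − s)·min{μ, 1 − μ}. -/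
open Metric Set

universe u

theorem norm_segment_sub_le_of_le {X : Type u} [NormedAddCommGroup X] [NormedSpace ℝ X]
    {x c d : X} {r s ρ μ : ℝ} (hr : 0 ≤ r) (hs1 : s ≤ 1) (hc : ‖c - x‖ ≤ r)
    (hρ1 : ρ ≤ 1) (hρ : ‖(1 - ρ) • c + ρ • d - x‖ ≤ s * r) (hμ0 : 0 ≤ μ) (hμρ : μ ≤ ρ) :
    ‖(1 - μ) • c + μ • d - x‖ ≤ r - r * (1 - s) * μ := by
  obtain ⟨t, ht0, ht1, rfl⟩ : ∃ t : ℝ, 0 ≤ t ∧ t ≤ 1 ∧ μ = t * ρ := by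
    rcases (hμ0.trans hμρ).eq_or_lt with h | h
    · exact ⟨0, le_rfl, zero_le_one, by linarith⟩
    · exact ⟨μ / ρ, by positivity, (div_le_one h).2 hμρ, by field_simp⟩
  have hcomb : (1 - t * ρ) • c + (t * ρ) • d - x =
      (1 - t) • (c - x) + t • ((1 - ρ) • c + ρ • d - x) := by
    module
  have ht : t * ρ ≤ t := mul_le_of_le_one_right ht0 hρ1
  have hrs : 0 ≤ r * (1 - s) := mul_nonneg hr (sub_nonneg.2 hs1)
  calc ‖(1 - t * ρ) • c + (t * ρ) • d - x‖
      ≤ (1 - t) * ‖c - x‖ + t * ‖(1 - ρ) • c + ρ • d - x‖ := by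
        rw [hcomb]
        refine (norm_add_le _ _).trans_eq ?_
        rw [norm_smul_of_nonneg (sub_nonneg.2 ht1), norm_smul_of_nonneg ht0]
    _ ≤ (1 - t) * r + t * (s * r) := by
        have := sub_nonneg.2 ht1
        gcongr
    _ = r - r * (1 - s) * t := by ring
    _ ≤ r - r * (1 - s) * (t * ρ) := by gcongr

/-- Lemma 4.4 (convexity lemma in an arbitrary Banach space): if `c, d ∈ B(x,r)` and
the segment `[c,d]` meets `B(x, s·r)`, then points of the segment are quantitatively
inside `B(x,r)`. -/
theorem statement12 {X : Type u} [NormedAddCommGroup X] [NormedSpace ℝ X] [CompleteSpace X]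
    (x c d : X) (r s : ℝ) (hr : 0 < r) (hs0 : 0 < s) (hs1 : s < 1)
    (hc : c ∈ closedBall x r) (hd : d ∈ closedBall x r)
    (hseg : ∃ ρ : ℝ, ρ ∈ Set.Icc (0 : ℝ) 1 ∧ ‖(1 - ρ) • c + ρ • d - x‖ ≤ s * r) :
    ∀ μ : ℝ, μ ∈ Set.Icc (0 : ℝ) 1 →
      ‖(1 - μ) • c + μ • d - x‖ ≤ r - r * (1 - s) * min μ (1 - μ) := by
  rintro μ ⟨hμ0, hμ1⟩
  obtain ⟨ρ, ⟨hρ0, hρ1⟩, hρ⟩ := hseg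
  rw [mem_closedBall_iff_norm] at hc hd
  have hrs : 0 ≤ r * (1 - s) := mul_nonneg hr.le (sub_nonneg.2 hs1.le)
  rcases le_total μ ρ with h | h
  · refine (norm_segment_sub_le_of_le hr.le hs1.le hc hρ1 hρ hμ0 h).trans ?_
    gcongr
    exact min_le_left _ _
  · have hρ' : ‖(1 - (1 - ρ)) • d + (1 - ρ) • c - x‖ ≤ s * r := by
      rwa [sub_sub_cancel, add_comm (ρ • d)]
    have key := norm_segment_sub_le_of_le (μ := 1 - μ) hr.le hs1.le hd (by linarith) hρ'
      (by linarith) (by linarith)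
    rw [sub_sub_cancel, add_comm (μ • d)] at key
    refine key.trans ?_
    gcongr
    exact min_le_right _ _
end

section
/- Let X be a real Banach space, let T ⊆ X be a nonempty compact connected set, let R ⊆ X be a set, and let (U_i)_{i ∈ ℕ} be a countable family of bounded subsets of X such that T ⊆ R ∪ ⋃_{i ∈ ℕ} U_i. Then diam T ≤ H^1(R ∩ T) + Σ_{i ∈ ℕ, U_i ∩ T ≠ ∅} diam U_i, where H^1 denotes the one-dimensional Hausdorff measure on X. -/
open Metric MeasureTheory Set Bornology
open scoped ENNReal Classical

universe u

/-- Lemma 4.6 (coarse estimate): if a nonempty compact connected set `T` in a Banach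
space is covered by `R` together with countably many bounded sets `U i`, then
`diam T ≤ H¹(R ∩ T) + Σ_{U i ∩ T ≠ ∅} diam (U i)`. -/
theorem statement15 (X : Type u) [NormedAddCommGroup X] [NormedSpace ℝ X] [CompleteSpace X]
    [MeasurableSpace X] [BorelSpace X]
    (T R : Set X) (U : ℕ → Set X)
    (hT : T.Nonempty) (hTc : IsCompact T) (hTconn : IsPreconnected T)
    (hU : ∀ i, IsBounded (U i))
    (hcover : T ⊆ R ∪ ⋃ i, U i) :
    ENNReal.ofReal (Metric.diam T) ≤
      μH[1] (R ∩ T) +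
        ∑' i : ℕ, if (U i ∩ T).Nonempty then ENNReal.ofReal (Metric.diam (U i)) else 0 := by
  refine ENNReal.ofReal_toReal_le.trans (Metric.ediam_le fun x hx y hy => ?_)
  have hf : LipschitzWith 1 fun z : X => dist z x := LipschitzWith.dist_left x
  calc edist x y = volume (Icc 0 (dist y x)) := by
        rw [Real.volume_Icc, sub_zero, ← edist_dist, edist_comm]
    _ ≤ volume ((dist · x) '' (R ∩ T) ∪ ⋃ i, (dist · x) '' (U i ∩ T)) := by
        have hsub : Icc 0 (dist y x) ⊆ (dist · x) '' T := by
          simpa using hTconn.intermediate_value hx hy hf.continuous.continuousOn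
        rw [← image_iUnion, ← image_union, ← iUnion_inter, ← union_inter_distrib_right,
          inter_eq_right.mpr hcover]
        exact measure_mono hsub
    _ ≤ volume ((dist · x) '' (R ∩ T)) + ∑' i, volume ((dist · x) '' (U i ∩ T)) :=
        (measure_union_le _ _).trans (by gcongr; exact measure_iUnion_le _)
    _ ≤ _ := by
        gcongr with i
        · rw [← hausdorffMeasure_real]
          simpa using hf.hausdorffMeasure_image_le zero_le_one (R ∩ T)
        · split_ifs with h
          · calc volume ((dist · x) '' (U i ∩ T)) ≤ Metric.ediam ((dist · x) '' (U i ∩ T)) :=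
                  Real.volume_le_diam _
              _ ≤ Metric.ediam (U i ∩ T) := by simpa using hf.ediam_image_le (U i ∩ T)
              _ ≤ Metric.ediam (U i) := Metric.ediam_mono inter_subset_left
              _ = ENNReal.ofReal (Metric.diam (U i)) :=
                  (ENNReal.ofReal_toReal (hU i).ediam_ne_top).symm
          · simp [not_nonempty_iff_eq_empty.mp h]
end

section
/- Let X be a real Banach space, let A > 1, and let (X_k)_{k ∈ ℤ} be a family of subsets of X with X_k ⊆ X_{k+1} such that any two distinct points of X_k are at distance ≥ 2^{-k}. Fix an integer J ≥ 4, a real 0 < c ≤ 1/5, and 0 ≤ j ≤ J − 1. For k ∈ ℤ and x ∈ X_k, define the (J,c)-core U of the ball Q = B(x, A·2^{-k}) recursively by: U_0 := B(x, c·2^{-k}); for i ≥ 1, U_i := U_{i−1} ∪ ⋃{B(y, c·2^{-(k+Jm)}) : m ≥ 1, y ∈ X_{k+Jm}, B(y, c·2^{-(k+Jm)}) ∩ U_{i−1} ≠ ∅}; and U := ⋃_{i ≥ 0} U_i. Then for any k, m ∈ ℤ with k ≡ j (mod J) and m ≡ j (mod J), any x ∈ X_k and y ∈ X_m, writing U and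 U' for the cores of B(x, A·2^{-k}) and B(y, A·2^{-m}): (i) B(x, c·2^{-k}) ⊆ U ⊆ B(x, (1 + 3·2^{-J})·c·2^{-k}) ⊆ B(x, (1/4)·2^{-k}); (ii) if k = m and x ≠ y, then gap(U, U') ≥ (1/2)·2^{-k}; (iii) if m ≥ k and U ∩ U' ≠ ∅, then U' ⊆ U. -/
open Metric Set
open scoped Classical

universe u

noncomputable section

/-- The stages of the `(J,c)`-core of the ball `B(x, A·2^{-k})`: `U₀ = B(x, c·2^{-k})`
and `U_{i+1}` adds all balls `B(y, c·2^{-(k+Jm)})`, `m ≥ 1`, `y ∈ net (k+Jm)`,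
that meet `U_i`. -/
def coreAux {X : Type u} [NormedAddCommGroup X]
    (net : ℤ → Set X) (J : ℤ) (c : ℝ) (k : ℤ) (x : X) : ℕ → Set X
  | 0 => closedBall x (c * (2 : ℝ) ^ (-k))
  | i + 1 =>
    coreAux net J c k x i ∪
      ⋃ (m : ℕ), ⋃ (y ∈ net (k + J * ((m : ℤ) + 1))),
        ⋃ (_ : (closedBall y (c * (2 : ℝ) ^ (-(k + J * ((m : ℤ) + 1)))) ∩
            coreAux net J c k x i).Nonempty),
          closedBall y (c * (2 : ℝ) ^ (-(k + J * ((m : ℤ) + 1))))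

/-- The `(J,c)`-core of the ball `B(x, A·2^{-k})`. -/
def core {X : Type u} [NormedAddCommGroup X]
    (net : ℤ → Set X) (J : ℤ) (c : ℝ) (k : ℤ) (x : X) : Set X :=
  ⋃ i : ℕ, coreAux net J c k x i

/-- The ball `B(y, c·2^{-n})` attached to a node `a = (n, y)`. -/
def nodeBall {X : Type u} [NormedAddCommGroup X] (c : ℝ) (a : ℤ × X) : Set X :=
  closedBall a.2 (c * (2 : ℝ) ^ (-a.1))

/-- Nodes centered in the net whose level is at most `N`, congruent to `p` modulo `J`, and
at least `p + J`. -/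
def IsFinerNode {X : Type u} (net : ℤ → Set X) (J p N : ℤ) (a : ℤ × X) : Prop :=
  p + J ≤ a.1 ∧ J ∣ a.1 - p ∧ a.1 ≤ N ∧ a.2 ∈ net a.1

/-- A step from `a` to a node of level finer than `p` whose ball meets the ball of `a`. -/
def CoreStep {X : Type u} [NormedAddCommGroup X] (net : ℤ → Set X) (J : ℤ) (c : ℝ) (p N : ℤ)
    (a b : ℤ × X) : Prop :=
  IsFinerNode net J p N b ∧ (nodeBall c a ∩ nodeBall c b).Nonempty

open Relation

section

variable {X : Type u} {net : ℤ → Set X} {J : ℤ} {c : ℝ}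

lemma IsFinerNode.trans {p N : ℤ} {a b : ℤ × X} (hJ : 0 ≤ J)
    (ha : IsFinerNode net J p N a) (hb : IsFinerNode net J a.1 N b) :
    IsFinerNode net J p N b := by
  obtain ⟨h1, h2, -, -⟩ := ha
  obtain ⟨h3, h4, h5, h6⟩ := hb
  refine ⟨by linarith, ?_, h5, h6⟩
  have := dvd_add h4 h2
  rwa [sub_add_sub_cancel] at this

lemma IsFinerNode.of_dvd_of_lt {p q N : ℤ} {b : ℤ × X} (hb : IsFinerNode net J p N b)
    (hq : J ∣ q - p) (hlt : q < b.1) : IsFinerNode net J q N b := by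
  obtain ⟨-, h2, h3, h4⟩ := hb
  have hd : J ∣ b.1 - q := by
    have := dvd_sub h2 hq
    rwa [sub_sub_sub_cancel_right] at this
  exact ⟨by linarith [Int.le_of_dvd (by linarith) hd], hd, h3, h4⟩

variable [NormedAddCommGroup X]

lemma reflTransGen_coreStep_mono {p N M : ℤ} (h : N ≤ M) {a b : ℤ × X}
    (hab : ReflTransGen (CoreStep net J c p N) a b) :
    ReflTransGen (CoreStep net J c p M) a b :=
  ReflTransGen.mono
    (fun _ _ hs => ⟨⟨hs.1.1, hs.1.2.1, hs.1.2.2.1.trans h, hs.1.2.2.2⟩, hs.2⟩) _ _ hab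

/-- Walks starting at a finer node can be traversed in both directions. -/
lemma reflTransGen_coreStep_of_isFinerNode {p N : ℤ} {t b : ℤ × X} (hJ : 0 ≤ J)
    (ht : IsFinerNode net J p N t) (h : ReflTransGen (CoreStep net J c t.1 N) t b) :
    IsFinerNode net J p N b ∧ ReflTransGen (CoreStep net J c p N) b t ∧
      ReflTransGen (CoreStep net J c p N) t b := by
  induction h with
  | refl => exact ⟨ht, .refl, .refl⟩
  | tail _ hs ih =>
    obtain ⟨hb, h1, h2⟩ := ih
    have hb' := ht.trans hJ hs.1
    exact ⟨hb', .head ⟨hb, inter_comm _ _ ▸ hs.2⟩ h1, h2.tail ⟨hb', hs.2⟩⟩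

lemma two_zpow_neg_le_sixteenth (hJ : 4 ≤ J) : (2 : ℝ) ^ (-J) ≤ 1 / 16 := by
  calc (2 : ℝ) ^ (-J) ≤ 2 ^ (-4 : ℤ) := zpow_le_zpow_right₀ (by norm_num) (by linarith)
    _ = 1 / 16 := by norm_num

lemma core_radius_le (hJ : 4 ≤ J) (hc0 : 0 < c) (hc : c ≤ 1 / 5) :
    (1 + 3 * (2 : ℝ) ^ (-J)) * c ≤ 19 / 80 := by
  nlinarith [two_zpow_neg_le_sixteenth hJ]

/-- A walk through nodes finer than `p` stays close to the ball it starts from. -/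
lemma nodeBall_subset_of_reflTransGen
    (hsep : ∀ k : ℤ, ∀ x ∈ net k, ∀ y ∈ net k, x ≠ y → (2 : ℝ) ^ (-k) ≤ dist x y)
    (hJ : 4 ≤ J) (hc0 : 0 < c) (hc : c ≤ 1 / 5) (N : ℤ) (d : ℕ) :
    ∀ p : ℤ, N - p ≤ d → ∀ (z : X) (b : ℤ × X),
      ReflTransGen (CoreStep net J c p N) (p, z) b →
        nodeBall c b ⊆ closedBall z ((1 + 3 * (2 : ℝ) ^ (-J)) * (c * (2 : ℝ) ^ (-p))) := by
  have hδ := two_zpow_neg_le_sixteenth hJ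
  have hδ0 : (0 : ℝ) < 2 ^ (-J) := by positivity
  induction d with
  | zero =>
    intro p hp z b h
    rcases h.cases_tail with rfl | ⟨a, -, hs⟩
    · refine closedBall_subset_closedBall ?_
      exact le_mul_of_one_le_left (by positivity) (by linarith)
    · obtain ⟨⟨h1, -, h3, -⟩, -⟩ := hs
      push_cast at hp
      lia
  | succ d ih =>
    intro p hp z b h
    have key : b = (p, z) ∨ ∃ t a : ℤ × X, IsFinerNode net J p N t ∧
        ReflTransGen (CoreStep net J c t.1 N) t a ∧
        (nodeBall c (p, z) ∩ nodeBall c a).Nonempty ∧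
        ReflTransGen (CoreStep net J c t.1 N) t b := by
      induction h with
      | refl => exact .inl rfl
      | @tail b b' _ hs ihb =>
        right
        obtain ⟨hb', hmeet⟩ := hs
        rcases ihb with rfl | ⟨t, a, ht, hta, ha, htb⟩
        · exact ⟨b', b', hb', .refl, hmeet, .refl⟩
        rcases lt_trichotomy t.1 b'.1 with hlt | heq | hgt
        · exact ⟨t, a, ht, hta, ha, htb.tail ⟨hb'.of_dvd_of_lt ht.2.1 hlt, hmeet⟩⟩
        · suffices hbt : b' = t by
            subst hbt
            exact ⟨b', a, ht, hta, ha, .refl⟩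
          refine Prod.ext heq.symm ?_
          by_contra hne
          have hfar := hsep b'.1 b'.2 hb'.2.2.2 t.2 (heq ▸ ht.2.2.2) hne
          obtain ⟨v, hvb, hvb'⟩ := hmeet
          have hv := ih t.1 (by have := ht.1; push_cast at hp; lia) t.2 b htb hvb
          rw [nodeBall, mem_closedBall] at hvb'
          rw [mem_closedBall, heq, ← mul_assoc] at hv
          have htri := dist_triangle_left b'.2 t.2 v
          have hpos : (0 : ℝ) < 2 ^ (-b'.1) := by positivity
          nlinarith [core_radius_le hJ hc0 hc]
        · have ht' : IsFinerNode net J b'.1 N t := ht.of_dvd_of_lt hb'.2.1 hgt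
          have hJ0 : 0 ≤ J := by linarith
          obtain ⟨hbf, hbt, -⟩ := reflTransGen_coreStep_of_isFinerNode hJ0 ht' htb
          obtain ⟨-, -, hta'⟩ := reflTransGen_coreStep_of_isFinerNode hJ0 ht' hta
          exact ⟨b', a, hb', .head ⟨hbf, inter_comm _ _ ▸ hmeet⟩ (hbt.trans hta'), ha, .refl⟩
    rcases key with rfl | ⟨t, a, ht, hta, ⟨v, hvz, hva⟩, htb⟩
    · refine closedBall_subset_closedBall ?_
      exact le_mul_of_one_le_left (by positivity) (by linarith)
    · intro w hw
      have hd : N - t.1 ≤ d := by have := ht.1; push_cast at hp; lia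
      have hw' := ih t.1 hd t.2 b htb hw
      have hv' := ih t.1 hd t.2 a hta hva
      rw [mem_closedBall] at hw' hv' ⊢
      rw [nodeBall, mem_closedBall] at hvz
      have hle : (2 : ℝ) ^ (-t.1) ≤ 2 ^ (-J) * 2 ^ (-p) := by
        rw [← zpow_add₀ (by norm_num)]
        exact zpow_le_zpow_right₀ (by norm_num) (by linarith [ht.1])
      have htri := dist_triangle4 w t.2 v z
      rw [dist_comm t.2 v] at htri
      have hr : (1 + 3 * (2 : ℝ) ^ (-J)) * (c * 2 ^ (-t.1)) ≤
          3 / 2 * (c * (2 ^ (-J) * 2 ^ (-p))) := by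
        gcongr
        linarith
      dsimp only at hvz
      linarith

lemma coreAux_subset_core (k : ℤ) (x : X) (i : ℕ) : coreAux net J c k x i ⊆ core net J c k x :=
  subset_iUnion (coreAux net J c k x) i

lemma nodeBall_subset_core (hJ : 0 < J) {k N : ℤ} {x : X} {b : ℤ × X}
    (h : ReflTransGen (CoreStep net J c k N) (k, x) b) : nodeBall c b ⊆ core net J c k x := by
  suffices ∃ i, nodeBall c b ⊆ coreAux net J c k x i by
    obtain ⟨i, hi⟩ := this
    exact hi.trans (coreAux_subset_core k x i)
  induction h with
  | refl => exact ⟨0, subset_rfl⟩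
  | @tail a b _ hs ih =>
    obtain ⟨i, hi⟩ := ih
    obtain ⟨⟨h1, ⟨e, he⟩, -, h4⟩, v, hva, hvb⟩ := hs
    obtain ⟨l, y⟩ := b
    have he1 : 1 ≤ e := by
      by_contra! hlt
      have : J * e ≤ 0 := mul_nonpos_of_nonneg_of_nonpos hJ.le (by lia)
      linarith
    obtain ⟨n, hn⟩ := Int.eq_ofNat_of_zero_le (sub_nonneg.2 he1)
    obtain rfl : l = k + J * ((n : ℤ) + 1) := by
      rw [← hn, sub_add_cancel, ← he]
      ring
    refine ⟨i + 1, fun w hw => .inr ?_⟩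
    simp only [mem_iUnion]
    exact ⟨n, y, h4, ⟨v, hvb, hi hva⟩, hw⟩

lemma exists_reflTransGen_of_mem_core (hJ : 0 < J) {k : ℤ} {x w : X}
    (hw : w ∈ core net J c k x) :
    ∃ (N : ℤ) (b : ℤ × X), ReflTransGen (CoreStep net J c k N) (k, x) b ∧ w ∈ nodeBall c b := by
  obtain ⟨i, hi⟩ := mem_iUnion.1 hw
  clear hw
  induction i generalizing w with
  | zero => exact ⟨0, (k, x), .refl, hi⟩
  | succ i ih =>
    rcases hi with hi | hi
    · exact ih hi
    simp only [mem_iUnion] at hi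
    obtain ⟨n, y, hy, ⟨v, hvy, hv⟩, hwy⟩ := hi
    obtain ⟨N, b, hb, hvb⟩ := ih hv
    refine ⟨max N (k + J * ((n : ℤ) + 1)), (k + J * ((n : ℤ) + 1), y),
      (reflTransGen_coreStep_mono (le_max_left _ _) hb).tail
        ⟨⟨?_, ⟨(n : ℤ) + 1, by ring⟩, le_max_right _ _, hy⟩, v, hvb, hvy⟩, hwy⟩
    have : 0 ≤ J * (n : ℤ) := by positivity
    linarith

lemma core_subset_closedBall
    (hsep : ∀ k : ℤ, ∀ x ∈ net k, ∀ y ∈ net k, x ≠ y → (2 : ℝ) ^ (-k) ≤ dist x y)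
    (hJ : 4 ≤ J) (hc0 : 0 < c) (hc : c ≤ 1 / 5) (k : ℤ) (x : X) :
    core net J c k x ⊆ closedBall x ((1 + 3 * (2 : ℝ) ^ (-J)) * (c * (2 : ℝ) ^ (-k))) := by
  intro w hw
  obtain ⟨N, b, hb, hwb⟩ := exists_reflTransGen_of_mem_core (by linarith) hw
  exact nodeBall_subset_of_reflTransGen hsep hJ hc0 hc N (N - k).toNat k
    (Int.self_le_toNat _) x b hb hwb

lemma half_le_dist_of_mem_core
    (hsep : ∀ k : ℤ, ∀ x ∈ net k, ∀ y ∈ net k, x ≠ y → (2 : ℝ) ^ (-k) ≤ dist x y)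
    (hJ : 4 ≤ J) (hc0 : 0 < c) (hc : c ≤ 1 / 5) {k : ℤ} {x y s t : X}
    (hx : x ∈ net k) (hy : y ∈ net k) (hxy : x ≠ y)
    (hs : s ∈ core net J c k x) (ht : t ∈ core net J c k y) :
    1 / 2 * (2 : ℝ) ^ (-k) ≤ dist s t := by
  have hs' := core_subset_closedBall hsep hJ hc0 hc k x hs
  have ht' := core_subset_closedBall hsep hJ hc0 hc k y ht
  rw [mem_closedBall, ← mul_assoc] at hs' ht'
  have htri := dist_triangle4 x s t y
  rw [dist_comm x s] at htri
  have hpos : (0 : ℝ) < 2 ^ (-k) := by positivity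
  nlinarith [core_radius_le hJ hc0 hc, hsep k x hx y hy hxy]

lemma core_subset_core_of_lt (hJ : 0 < J) {k m : ℤ} {x y : X} (hkm : k < m) (hdvd : J ∣ m - k)
    (hy : y ∈ net m) (h : (core net J c k x ∩ core net J c m y).Nonempty) :
    core net J c m y ⊆ core net J c k x := by
  obtain ⟨v, hvx, hvy⟩ := h
  intro w hw
  obtain ⟨N₁, a, ha, hva⟩ := exists_reflTransGen_of_mem_core hJ hvx
  obtain ⟨N₂, b, hb, hvb⟩ := exists_reflTransGen_of_mem_core hJ hvy
  obtain ⟨N₃, e, he, hwe⟩ := exists_reflTransGen_of_mem_core hJ hw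
  set N := max (max N₁ N₂) (max N₃ m) with hN
  have hfine : IsFinerNode net J k N (m, y) :=
    ⟨by linarith [Int.le_of_dvd (by linarith) hdvd], hdvd, by simp [hN], hy⟩
  obtain ⟨hbf, hby, -⟩ := reflTransGen_coreStep_of_isFinerNode hJ.le hfine
    (reflTransGen_coreStep_mono (by simp [hN]) hb)
  obtain ⟨-, -, hye⟩ := reflTransGen_coreStep_of_isFinerNode hJ.le hfine
    (reflTransGen_coreStep_mono (by simp [hN]) he)
  have hxa := reflTransGen_coreStep_mono (M := N) (by simp [hN]) ha
  exact nodeBall_subset_core hJ (((hxa.tail ⟨hbf, v, hva, hvb⟩).trans hby).trans hye) hwe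

end

/-- Lemma 2.3 (properties of cores): shape, separation within levels, and tree
structure of the `(J,c)`-cores associated to levels `k ≡ j (mod J)`. -/
theorem statement16 (X : Type u) [NormedAddCommGroup X] [NormedSpace ℝ X] [CompleteSpace X]
    (A : ℝ) (hA : 1 < A) (net : ℤ → Set X)
    (hnested : ∀ k : ℤ, net k ⊆ net (k + 1))
    (hsep : ∀ k : ℤ, ∀ x ∈ net k, ∀ y ∈ net k, x ≠ y → (2 : ℝ) ^ (-k) ≤ dist x y)
    (J : ℤ) (hJ : 4 ≤ J) (c : ℝ) (hc0 : 0 < c) (hc : c ≤ 1 / 5)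
    (j : ℤ) (hj0 : 0 ≤ j) (hjJ : j ≤ J - 1) :
    ∀ k m : ℤ, k % J = j → m % J = j → ∀ x ∈ net k, ∀ y ∈ net m,
      (closedBall x (c * (2 : ℝ) ^ (-k)) ⊆ core net J c k x ∧
        core net J c k x ⊆
          closedBall x ((1 + 3 * (2 : ℝ) ^ (-J)) * (c * (2 : ℝ) ^ (-k))) ∧
        closedBall x ((1 + 3 * (2 : ℝ) ^ (-J)) * (c * (2 : ℝ) ^ (-k))) ⊆
          closedBall x ((1 / 4) * (2 : ℝ) ^ (-k))) ∧
      (k = m → x ≠ y → ∀ s ∈ core net J c k x, ∀ t ∈ core net J c m y,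
        (1 / 2) * (2 : ℝ) ^ (-k) ≤ dist s t) ∧
      (k ≤ m → (core net J c k x ∩ core net J c m y).Nonempty →
        core net J c m y ⊆ core net J c k x) := by
  intro k m hk hm x hx y hy
  have hJ0 : 0 < J := by linarith
  refine ⟨⟨coreAux_subset_core k x 0, core_subset_closedBall hsep hJ hc0 hc k x,
    closedBall_subset_closedBall ?_⟩, ?_, ?_⟩
  · rw [← mul_assoc]
    gcongr
    linarith [core_radius_le hJ hc0 hc]
  · rintro rfl hxy s hs t ht
    exact half_le_dist_of_mem_core hsep hJ hc0 hc hx hy hxy hs ht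
  · intro hkm hne
    rcases hkm.eq_or_lt with rfl | hlt
    · obtain rfl | hxy := eq_or_ne x y
      · exact subset_rfl
      · obtain ⟨v, hvx, hvy⟩ := hne
        have := half_le_dist_of_mem_core hsep hJ hc0 hc hx hy hxy hvx hvy
        rw [dist_self] at this
        have hpos : (0 : ℝ) < 2 ^ (-k) := by positivity
        linarith
    · exact core_subset_core_of_lt hJ0 hlt (Int.ModEq.dvd (hk.trans hm.symm)) hy hne

end
end
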